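/- Suppose that A ⊆ G := 𝔽₂ⁿ has density α with 0 < α ≤ 1/2. Then A + A contains a subspace of dimension at least α·n/log 2 − 1 (logarithm to base e). -/

import Mathlib

open Pointwise

/-- The nontrivial real character of `𝔽₂`. -/
def zmodTwoSign (t : ZMod 2) : ℝ := if t = 0 then 1 else -1

lemma zmodTwoSign_zero : zmodTwoSign 0 = 1 := by simp [zmodTwoSign]

lemma zmodTwoSign_one : zmodTwoSign 1 = -1 := by simp [zmodTwoSign]

lemma zmodTwoSign_add (s t : ZMod 2) :
    zmodTwoSign (s + t) = zmodTwoSign s * zmodTwoSign t := by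
  have h : ∀ u : ZMod 2, u = 0 ∨ u = 1 := by decide
  have h₁ : (1 : ZMod 2) + 1 = 0 := by decide
  obtain rfl | rfl := h s <;> obtain rfl | rfl := h t <;> simp [zmodTwoSign, h₁]

lemma ite_eq_zero_eq_zmodTwoSign (t : ZMod 2) :
    (if t = 0 then 1 else 0 : ℝ) = (1 + zmodTwoSign t) / 2 := by
  unfold zmodTwoSign
  split_ifs <;> norm_num

lemma sum_zmodTwoSign_dotProduct {n : ℕ} (x : Fin n → ZMod 2) :
    ∑ γ : Fin n → ZMod 2, zmodTwoSign (γ ⬝ᵥ x) = if x = 0 then 2 ^ n else 0 := by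
  split_ifs with hx
  · simp [hx, zmodTwoSign_zero, ZMod.card]
  · obtain ⟨i, hi⟩ := Function.ne_iff.mp hx
    have hi : x i = 1 := Fin.eq_one_of_ne_zero _ hi
    have h := Equiv.sum_comp (Equiv.addRight (Pi.single i (1 : ZMod 2)))
      fun γ : Fin n → ZMod 2 => zmodTwoSign (γ ⬝ᵥ x)
    simp only [Equiv.coe_addRight, add_dotProduct, single_dotProduct, hi, mul_one,
      zmodTwoSign_add, zmodTwoSign_one, mul_neg, Finset.sum_neg_distrib] at h
    linarith

/-- The unnormalised Fourier coefficient of the indicator function of `A` at `γ`. -/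
def indicatorFourier {n : ℕ} (A : Finset (Fin n → ZMod 2)) (γ : Fin n → ZMod 2) : ℝ :=
  ∑ x ∈ A, zmodTwoSign (γ ⬝ᵥ x)

lemma indicatorFourier_zero {n : ℕ} (A : Finset (Fin n → ZMod 2)) :
    indicatorFourier A 0 = A.card := by
  simp [indicatorFourier, zmodTwoSign_zero]

lemma sum_indicatorFourier_sq_mul {n : ℕ} (A : Finset (Fin n → ZMod 2)) (s : Fin n → ZMod 2) :
    ∑ γ, indicatorFourier A γ ^ 2 * zmodTwoSign (γ ⬝ᵥ s) =
      ∑ x ∈ A, ∑ y ∈ A, if x + y = s then 2 ^ n else 0 := by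
  have h : ∀ x y : Fin n → ZMod 2, x + y = s ↔ x + y + s = 0 := fun x y => by
    rw [add_eq_zero_iff_eq_neg, ZModModule.neg_eq_self]
  simp_rw [h, ← sum_zmodTwoSign_dotProduct, dotProduct_add, zmodTwoSign_add, indicatorFourier, sq,
    Finset.sum_mul_sum, Finset.sum_mul]
  rw [Finset.sum_comm]
  exact Finset.sum_congr rfl fun x _ => Finset.sum_comm

lemma sum_indicatorFourier_sq_mul_of_notMem {n : ℕ} {A : Finset (Fin n → ZMod 2)}
    {s : Fin n → ZMod 2} (hs : s ∉ A + A) :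
    ∑ γ, indicatorFourier A γ ^ 2 * zmodTwoSign (γ ⬝ᵥ s) = 0 := by
  rw [sum_indicatorFourier_sq_mul]
  refine Finset.sum_eq_zero fun x hx => Finset.sum_eq_zero fun y hy => if_neg ?_
  rintro rfl
  exact hs (Finset.add_mem_add hx hy)

lemma sum_indicatorFourier_sq {n : ℕ} (A : Finset (Fin n → ZMod 2)) :
    ∑ γ, indicatorFourier A γ ^ 2 = 2 ^ n * A.card := by
  have h := sum_indicatorFourier_sq_mul A 0
  simp only [dotProduct_zero, zmodTwoSign_zero, mul_one] at h
  have h' : ∀ x y : Fin n → ZMod 2, x + y = 0 ↔ x = y := fun x y => by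
    rw [add_eq_zero_iff_eq_neg, ZModModule.neg_eq_self]
  rw [h]
  simp [h', mul_comm]

/-- Some hyperplane through the origin contains at most a proportion `(1 - 2α) / (2 - 2α)` of a
given set of elements outside `A + A`. -/
lemma exists_card_filter_dotProduct_le {n : ℕ} {A T : Finset (Fin n → ZMod 2)} {α : ℝ}
    (hα : α = (A.card : ℝ) / 2 ^ n) (hα₀ : 0 < α) (hα₁ : α ≤ 1 / 2)
    (hT : ∀ s ∈ T, s ∉ A + A) :
    ∃ γ : Fin n → ZMod 2,
      ((T.filter fun s => γ ⬝ᵥ s = 0).card : ℝ) ≤ (1 - 2 * α) / (2 - 2 * α) * T.card := by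
  set r := (1 - 2 * α) / (2 - 2 * α) with hr
  have hcard : (A.card : ℝ) = α * 2 ^ n := by rw [hα]; field_simp
  have hpos : (0 : ℝ) < 2 ^ n := by positivity
  have hf : ∀ γ : Fin n → ZMod 2, ((T.filter fun s => γ ⬝ᵥ s = 0).card : ℝ) =
      ∑ s ∈ T, (1 + zmodTwoSign (γ ⬝ᵥ s)) / 2 := fun γ => by
    simp_rw [← ite_eq_zero_eq_zmodTwoSign, Finset.sum_boole]
  have herase (g : (Fin n → ZMod 2) → ℝ) :=
    Finset.sum_erase_eq_sub (f := g) (Finset.mem_univ (0 : Fin n → ZMod 2))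
  have hw : ∑ γ ∈ Finset.univ.erase 0, indicatorFourier A γ ^ 2 =
      (2 ^ n) ^ 2 * (α * (1 - α)) := by
    rw [herase, sum_indicatorFourier_sq, indicatorFourier_zero, hcard]
    ring
  have hwf : ∑ γ ∈ Finset.univ.erase 0, indicatorFourier A γ ^ 2 *
      ((T.filter fun s => γ ⬝ᵥ s = 0).card : ℝ) =
      T.card * ((2 ^ n) ^ 2 * (α * (1 - 2 * α) / 2)) := by
    simp_rw [hf, Finset.mul_sum]
    rw [Finset.sum_comm, ← nsmul_eq_mul]
    refine Finset.sum_eq_card_nsmul fun s hs => ?_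
    have h : ∀ γ : Fin n → ZMod 2, indicatorFourier A γ ^ 2 * ((1 + zmodTwoSign (γ ⬝ᵥ s)) / 2) =
        (indicatorFourier A γ ^ 2 + indicatorFourier A γ ^ 2 * zmodTwoSign (γ ⬝ᵥ s)) / 2 :=
      fun γ => by ring
    simp_rw [h]
    rw [← Finset.sum_div, herase, Finset.sum_add_distrib, sum_indicatorFourier_sq,
      sum_indicatorFourier_sq_mul_of_notMem (hT s hs), indicatorFourier_zero, zero_dotProduct,
      zmodTwoSign_zero, hcard]
    ring
  by_contra! hlt
  have hwpos : 0 < ∑ γ ∈ Finset.univ.erase 0, indicatorFourier A γ ^ 2 := by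
    rw [hw]
    have : 0 < 1 - α := by linarith
    positivity
  obtain ⟨γ, hγ, hγpos⟩ := Finset.exists_lt_of_sum_lt
    (Finset.sum_const_zero.trans_lt hwpos)
  have hsum : ∑ γ ∈ Finset.univ.erase 0, indicatorFourier A γ ^ 2 * (r * T.card) <
      ∑ γ ∈ Finset.univ.erase 0, indicatorFourier A γ ^ 2 *
        ((T.filter fun s => γ ⬝ᵥ s = 0).card : ℝ) :=
    Finset.sum_lt_sum (fun γ _ => mul_le_mul_of_nonneg_left (hlt γ).le (sq_nonneg _))
      ⟨γ, hγ, mul_lt_mul_of_pos_left (hlt γ) hγpos⟩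
  rw [← Finset.sum_mul, hw, hwf, hr] at hsum
  have hratio : (1 - α) * ((1 - 2 * α) / (2 - 2 * α)) = (1 - 2 * α) / 2 := by
    have : 1 - α ≠ 0 := by linarith
    rw [show 2 - 2 * α = 2 * (1 - α) by ring]
    field_simp
  refine hsum.ne ?_
  linear_combination (2 ^ n) ^ 2 * α * T.card * hratio

open Classical in
/-- Intersecting `d` hyperplanes gives a subspace of codimension at most `d` containing at most
a proportion `((1 - 2α) / (2 - 2α)) ^ d` of the elements outside `A + A`. -/
lemma exists_submodule_card_filter_le {n : ℕ} {A : Finset (Fin n → ZMod 2)} {α : ℝ}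
    (hα : α = (A.card : ℝ) / 2 ^ n) (hα₀ : 0 < α) (hα₁ : α ≤ 1 / 2) (d : ℕ) :
    ∃ V : Submodule (ZMod 2) (Fin n → ZMod 2), n ≤ Module.finrank (ZMod 2) V + d ∧
      (((A + A)ᶜ.filter (· ∈ V)).card : ℝ) ≤
        ((1 - 2 * α) / (2 - 2 * α)) ^ d * ((A + A)ᶜ.card : ℝ) := by
  induction d with
  | zero => exact ⟨⊤, by simp, by simp⟩
  | succ d ih =>
    obtain ⟨V, hV, hle⟩ := ih
    obtain ⟨γ, hγ⟩ := exists_card_filter_dotProduct_le (T := (A + A)ᶜ.filter (· ∈ V)) hα hα₀ hα₁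
      (fun s hs => by simpa using (Finset.mem_filter.mp hs).1)
    set φ : Module.Dual (ZMod 2) (Fin n → ZMod 2) := dotProductBilin (ZMod 2) (ZMod 2) γ
    have hφ : ∀ s, φ s = γ ⬝ᵥ s := fun s => rfl
    refine ⟨V ⊓ LinearMap.ker φ, ?_, ?_⟩
    · have h₁ := Submodule.finrank_sup_add_finrank_inf_eq V (LinearMap.ker φ)
      have h₂ := LinearMap.finrank_range_add_finrank_ker φ
      have h₃ := Submodule.finrank_le (V ⊔ LinearMap.ker φ)
      have h₄ := Submodule.finrank_le (LinearMap.range φ)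
      rw [Module.finrank_self] at h₄
      omega
    · simp only [Submodule.mem_inf, LinearMap.mem_ker, hφ, ← Finset.filter_filter]
      have hr : 0 ≤ (1 - 2 * α) / (2 - 2 * α) := div_nonneg (by linarith) (by linarith)
      calc _ ≤ _ := hγ
        _ ≤ _ := mul_le_mul_of_nonneg_left hle hr
        _ = _ := by ring

lemma mul_log_two_div_le_log_sub_log {α : ℝ} (hα₀ : 0 ≤ α) (hα₁ : α < 1 / 2) :
    Real.log 2 * α / (Real.log 2 - α) ≤ Real.log (1 - α) - Real.log (1 - 2 * α) := by
  set c := Real.log 2 with hc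
  have hc₁ : 0.69 < c := by linarith [Real.log_two_gt_d9]
  have hc₂ : c < 0.7 := by linarith [Real.log_two_lt_d9]
  let f : ℝ → ℝ := fun x => Real.log (1 - x) - Real.log (1 - 2 * x) - c * x / (c - x)
  have hderiv : ∀ x ∈ Set.Ico (0 : ℝ) (1 / 2), HasDerivAt f
      (-1 / (1 - x) - -2 / (1 - 2 * x) - (c * (c - x) - c * x * (-1)) / (c - x) ^ 2) x := by
    intro x hx
    have h₁ : 1 - x ≠ 0 := by linarith [hx.2]
    have h₂ : 1 - 2 * x ≠ 0 := by linarith [hx.2]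
    have h₃ : c - x ≠ 0 := by linarith [hx.2]
    have d₁ : HasDerivAt (fun x : ℝ => 1 - x) (-1) x := (hasDerivAt_id x).const_sub 1
    have d₂ : HasDerivAt (fun x : ℝ => 1 - 2 * x) (-2) x := by
      simpa using ((hasDerivAt_id x).const_mul 2).const_sub 1
    have d₃ : HasDerivAt (fun x : ℝ => c * x) c x := by
      simpa using (hasDerivAt_id x).const_mul c
    have d₄ : HasDerivAt (fun x : ℝ => c - x) (-1) x := (hasDerivAt_id x).const_sub c
    exact ((d₁.log h₁).sub (d₂.log h₂)).sub (d₃.div d₄ h₃)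
  have hmono : MonotoneOn f (Set.Ico 0 (1 / 2)) := by
    refine monotoneOn_of_deriv_nonneg (convex_Ico _ _)
      (fun x hx => (hderiv x hx).continuousAt.continuousWithinAt)
      (fun x hx => (hderiv x (interior_subset hx)).differentiableAt.differentiableWithinAt)
      fun x hx => ?_
    have hx' := interior_subset hx
    rw [(hderiv x hx').deriv]
    obtain ⟨hx₀, hx₁⟩ := hx'
    have h₁ : 0 < 1 - x := by linarith
    have h₂ : 0 < 1 - 2 * x := by linarith
    have h₃ : 0 < c - x := by linarith
    have key : c ^ 2 * ((1 - x) * (1 - 2 * x)) ≤ (c - x) ^ 2 := by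
      have h₄ : 0 ≤ x * (c * (3 * c - 2)) := by
        have : 0 ≤ 3 * c - 2 := by linarith
        positivity
      have h₅ : 0 ≤ x ^ 2 * (1 - 2 * c ^ 2) := by
        have : 0 ≤ 1 - 2 * c ^ 2 := by nlinarith
        positivity
      nlinarith
    have : -1 / (1 - x) - -2 / (1 - 2 * x) - (c * (c - x) - c * x * (-1)) / (c - x) ^ 2 =
        ((c - x) ^ 2 - c ^ 2 * ((1 - x) * (1 - 2 * x))) /
          ((1 - x) * (1 - 2 * x) * (c - x) ^ 2) := by
      have h₁' := h₁.ne'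
      have h₂' := h₂.ne'
      have h₃' := h₃.ne'
      rw [div_sub_div _ _ h₁' h₂', div_sub_div _ _ (mul_ne_zero h₁' h₂') (pow_ne_zero 2 h₃')]
      congr 1
      ring
    rw [this]
    exact div_nonneg (by linarith) (by positivity)
  have h := hmono (by norm_num : (0 : ℝ) ∈ Set.Ico (0 : ℝ) (1 / 2)) ⟨hα₀, hα₁⟩ hα₀
  simp only [f] at h
  norm_num at h
  linarith

/-- `⌈n (1 - α / log 2)⌉` hyperplanes suffice to shrink a set of size at most `2 ^ n` to size at
most one. -/
lemma pow_ceil_mul_two_pow_le_one {n : ℕ} (hn : n ≠ 0) {α : ℝ} (hα₀ : 0 ≤ α)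
    (hα₁ : α ≤ 1 / 2) :
    ((1 - 2 * α) / (2 - 2 * α)) ^ ⌈n * (1 - α / Real.log 2)⌉₊ * 2 ^ n ≤ 1 := by
  have hc : 0.69 < Real.log 2 := by linarith [Real.log_two_gt_d9]
  have hc₀ : 0 < Real.log 2 := by linarith
  have hfac : 0 < 1 - α / Real.log 2 := by
    rw [sub_pos, div_lt_one hc₀]
    linarith
  have hn' : (0 : ℝ) < n := by positivity
  rcases hα₁.eq_or_lt with rfl | hlt
  · have hd : ⌈n * (1 - 1 / 2 / Real.log 2)⌉₊ ≠ 0 := (Nat.ceil_pos.mpr (by positivity)).ne'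
    rw [show (1 : ℝ) - 2 * (1 / 2) = 0 by norm_num, zero_div, zero_pow hd, zero_mul]
    exact zero_le_one
  · have h₁ : 0 < 1 - 2 * α := by linarith
    have h₂ : 0 < 1 - α := by linarith
    have h₃ : 0 < Real.log 2 - α := by linarith
    have hr : 0 < (1 - 2 * α) / (2 - 2 * α) := div_pos h₁ (by linarith)
    rw [← Real.log_nonpos_iff (by positivity), Real.log_mul (by positivity) (by positivity),
      Real.log_pow, Real.log_pow, Real.log_div (by positivity) (by linarith),
      show 2 - 2 * α = 2 * (1 - α) by ring, Real.log_mul (by norm_num) h₂.ne']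
    have hlog := mul_log_two_div_le_log_sub_log hα₀ hlt
    set c := Real.log 2
    set M := Real.log (1 - α) - Real.log (1 - 2 * α) with hM
    have hceil := Nat.le_ceil (n * (1 - α / c))
    have hkey : c ≤ (1 - α / c) * (c + M) := by
      calc c = (1 - α / c) * (c + c * α / (c - α)) := by field_simp; ring
        _ ≤ _ := by gcongr
    have hM₀ : 0 ≤ c + M := by
      have : 0 ≤ c * α / (c - α) := by positivity
      linarith
    have h₄ := mul_le_mul_of_nonneg_right hceil hM₀
    have h₅ := mul_le_mul_of_nonneg_left hkey hn'.le
    linarith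

/-- If `A ⊆ 𝔽₂ⁿ` has density `α` with `0 < α ≤ 1/2`, then `A + A` contains a
subspace of dimension at least `α n / log 2 - 1`. -/
theorem sumset_contains_subspace_dim_ge_of_density {n : ℕ} (A : Finset (Fin n → ZMod 2)) (α : ℝ)
    (hα : α = (A.card : ℝ) / 2 ^ n) (hα₀ : 0 < α) (hα₁ : α ≤ 1 / 2) :
    ∃ V : Submodule (ZMod 2) (Fin n → ZMod 2),
      (V : Set (Fin n → ZMod 2)) ⊆ ((A + A : Finset (Fin n → ZMod 2)) : Set (Fin n → ZMod 2)) ∧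
      α * n / Real.log 2 - 1 ≤ (Module.finrank (ZMod 2) V : ℝ) := by
  classical
  have hA : A.Nonempty := by
    rw [Finset.nonempty_iff_ne_empty]
    rintro rfl
    simp [hα] at hα₀
  have hzero : (0 : Fin n → ZMod 2) ∈ A + A := by
    obtain ⟨x, hx⟩ := hA
    simpa [ZModModule.add_self] using Finset.add_mem_add hx hx
  rcases eq_or_ne n 0 with rfl | hn
  · exact ⟨⊥, by rwa [Submodule.bot_coe, Set.singleton_subset_iff], by simp⟩
  obtain ⟨V, hV, hle⟩ := exists_submodule_card_filter_le hα hα₀ hα₁ ⌈n * (1 - α / Real.log 2)⌉₊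
  refine ⟨V, ?_, ?_⟩
  · have hS : ((A + A)ᶜ.card : ℝ) < 2 ^ n := by
      have h := Finset.card_lt_univ_of_notMem (s := (A + A)ᶜ) (x := 0) (by simpa using hzero)
      rw [Fintype.card_fun, ZMod.card, Fintype.card_fin] at h
      exact_mod_cast h
    have hlt : (((A + A)ᶜ.filter (· ∈ V)).card : ℝ) < 1 := by
      have hr : 0 ≤ (1 - 2 * α) / (2 - 2 * α) := div_nonneg (by linarith) (by linarith)
      have hone := pow_ceil_mul_two_pow_le_one hn hα₀.le hα₁
      rcases (pow_nonneg hr ⌈n * (1 - α / Real.log 2)⌉₊).eq_or_lt with h | h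
      · rw [← h] at hle
        linarith
      · linarith [mul_lt_mul_of_pos_left hS h]
    have hempty : (A + A)ᶜ.filter (· ∈ V) = ∅ := by
      rw [← Finset.card_eq_zero]
      exact_mod_cast Nat.lt_one_iff.mp (by exact_mod_cast hlt)
    intro v hv
    by_contra hv'
    exact Finset.filter_eq_empty_iff.mp hempty (Finset.mem_compl.mpr hv') hv
  · have hlog : Real.log 2 ≠ 0 := (Real.log_pos one_lt_two).ne'
    have hfac : 0 ≤ n * (1 - α / Real.log 2) := by
      refine mul_nonneg n.cast_nonneg ?_
      rw [sub_nonneg, div_le_one (Real.log_pos one_lt_two)]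
      linarith [Real.log_two_gt_d9]
    have hceil := Nat.ceil_lt_add_one hfac
    have hV' : (n : ℝ) ≤ Module.finrank (ZMod 2) V + ⌈n * (1 - α / Real.log 2)⌉₊ := by
      exact_mod_cast hV
    have : α * n / Real.log 2 = n - n * (1 - α / Real.log 2) := by ring
    linarith
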